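/- For each p ∈ (0,1), the minimum over λ > 0 of d_tv(X_{1,p}, Π_λ) is attained at λ*_p := min(-ln(1-p), 1), and this minimum equals p + (1-p)·ln(1-p) if p ≤ 1 - e^{-1}, and equals p - e^{-1} if p ≥ 1 - e^{-1}. -/

import Mathlib

/-- The Bernoulli(p) probability mass function on ℕ. -/
noncomputable def bernoulliPMF (p : ℝ) : ℕ → ℝ :=
  fun k => if k = 0 then 1 - p else if k = 1 then p else 0

/-- The Poisson(l) probability mass function on ℕ. -/
noncomputable def poissonPMF (l : ℝ) : ℕ → ℝ :=
  fun k => Real.exp (-l) * l ^ k / (Nat.factorial k)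

/-- Total variation distance between two distributions on ℕ. -/
noncomputable def dtv (P Q : ℕ → ℝ) : ℝ := (1 / 2) * ∑' k : ℕ, |P k - Q k|

theorem hasSum_poissonPMF (l : ℝ) : HasSum (poissonPMF l) 1 := by
  have h := (NormedSpace.expSeries_div_hasSum_exp l).mul_left (Real.exp (-l))
  rw [← Real.exp_eq_exp_ℝ, ← Real.exp_add, neg_add_cancel, Real.exp_zero] at h
  have heq : poissonPMF l = fun k => Real.exp (-l) * (l ^ k / (Nat.factorial k)) :=
    funext fun _ => mul_div_assoc _ _ _
  rwa [heq]

theorem poissonPMF_nonneg {l : ℝ} (hl : 0 ≤ l) (k : ℕ) : 0 ≤ poissonPMF l k := by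
  unfold poissonPMF
  positivity

theorem dtv_bernoulliPMF_poissonPMF (p : ℝ) {l : ℝ} (hl : 0 ≤ l) :
    dtv (bernoulliPMF p) (poissonPMF l) =
      1 / 2 * (|1 - p - Real.exp (-l)| + |p - l * Real.exp (-l)| +
        (1 - Real.exp (-l) - l * Real.exp (-l))) := by
  have htail : HasSum (fun k => poissonPMF l (k + 2))
      (1 - ∑ k ∈ Finset.range 2, poissonPMF l k) :=
    (hasSum_nat_add_iff' 2).mpr (hasSum_poissonPMF l)
  have habs : ∀ k, |bernoulliPMF p (k + 2) - poissonPMF l (k + 2)| = poissonPMF l (k + 2) := by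
    intro k
    have h : bernoulliPMF p (k + 2) = 0 := by simp [bernoulliPMF]
    rw [h, zero_sub, abs_neg, abs_of_nonneg (poissonPMF_nonneg hl _)]
  have hsum : HasSum (fun k => |bernoulliPMF p k - poissonPMF l k|)
      (1 - ∑ k ∈ Finset.range 2, poissonPMF l k +
        ∑ k ∈ Finset.range 2, |bernoulliPMF p k - poissonPMF l k|) := by
    rw [← hasSum_nat_add_iff 2]
    simpa only [habs] using htail
  rw [dtv, hsum.tsum_eq]
  simp only [Finset.sum_range_succ, Finset.sum_range_zero, bernoulliPMF, poissonPMF]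
  norm_num
  rw [mul_comm (Real.exp (-l)) l]
  ring

theorem one_add_mul_exp_neg_le {s l : ℝ} (hs : 0 ≤ s) (hsl : s ≤ l) :
    (1 + l) * Real.exp (-l) ≤ (1 + s) * Real.exp (-s) := by
  have h : Real.exp (-s) = Real.exp (l - s) * Real.exp (-l) := by
    rw [← Real.exp_add]
    ring_nf
  rw [h, ← mul_assoc]
  refine mul_le_mul_of_nonneg_right ?_ (Real.exp_pos _).le
  nlinarith [Real.add_one_le_exp (l - s), mul_nonneg hs (sub_nonneg.mpr hsl)]

theorem mul_exp_neg_le_of_le_one {s l : ℝ} (hs : 0 ≤ s) (hls : l ≤ s) (hs1 : s ≤ 1) :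
    l * Real.exp (-l) ≤ s * Real.exp (-s) := by
  have h : Real.exp (-s) = Real.exp (l - s) * Real.exp (-l) := by
    rw [← Real.exp_add]
    ring_nf
  rw [h, ← mul_assoc]
  refine mul_le_mul_of_nonneg_right ?_ (Real.exp_pos _).le
  nlinarith [Real.add_one_le_exp (l - s), mul_nonneg (sub_nonneg.mpr hls) (sub_nonneg.mpr hs1)]

theorem mul_exp_neg_le_exp_neg_one (l : ℝ) : l * Real.exp (-l) ≤ Real.exp (-1) := by
  have h : Real.exp (-1) = Real.exp (l - 1) * Real.exp (-l) := by
    rw [← Real.exp_add]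
    ring_nf
  rw [h]
  exact mul_le_mul_of_nonneg_right (by linarith [Real.add_one_le_exp (l - 1)]) (Real.exp_pos _).le

theorem sub_mul_exp_neg_le_dtv (p : ℝ) {l : ℝ} (hl : 0 ≤ l) :
    p - l * Real.exp (-l) ≤ dtv (bernoulliPMF p) (poissonPMF l) := by
  rw [dtv_bernoulliPMF_poissonPMF p hl]
  linarith [neg_abs_le (1 - p - Real.exp (-l)), le_abs_self (p - l * Real.exp (-l))]

theorem one_sub_le_dtv (p : ℝ) {l : ℝ} (hl : 0 ≤ l) :
    1 - (1 + l) * Real.exp (-l) ≤ dtv (bernoulliPMF p) (poissonPMF l) := by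
  rw [dtv_bernoulliPMF_poissonPMF p hl]
  linarith [le_abs_self (1 - p - Real.exp (-l)), le_abs_self (p - l * Real.exp (-l))]

theorem dtv_eq_of_one_sub_le_exp_neg {p l : ℝ} (hl : 0 ≤ l) (h : 1 - p ≤ Real.exp (-l)) :
    dtv (bernoulliPMF p) (poissonPMF l) = p - l * Real.exp (-l) := by
  have h1 : (1 + l) * Real.exp (-l) ≤ 1 := by
    simpa using one_add_mul_exp_neg_le le_rfl hl
  rw [dtv_bernoulliPMF_poissonPMF p hl, abs_of_nonpos (by linarith),
    abs_of_nonneg (by linarith)]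
  ring

theorem stmt_3 (p : ℝ) (hp : p ∈ Set.Ioo (0 : ℝ) 1) :
    (∀ l : ℝ, 0 < l →
      dtv (bernoulliPMF p) (poissonPMF (min (-Real.log (1 - p)) 1)) ≤
        dtv (bernoulliPMF p) (poissonPMF l)) ∧
    (p ≤ 1 - Real.exp (-1) →
      dtv (bernoulliPMF p) (poissonPMF (min (-Real.log (1 - p)) 1)) =
        p + (1 - p) * Real.log (1 - p)) ∧
    (1 - Real.exp (-1) ≤ p →
      dtv (bernoulliPMF p) (poissonPMF (min (-Real.log (1 - p)) 1)) =
        p - Real.exp (-1)) := by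
  obtain ⟨hp0, hp1⟩ := hp
  have hq : 0 < 1 - p := by linarith
  have hexp : Real.exp (- -Real.log (1 - p)) = 1 - p := by rw [neg_neg, Real.exp_log hq]
  have hlog : 0 ≤ -Real.log (1 - p) := by
    linarith [Real.log_nonpos hq.le (by linarith)]
  have hsmall : p ≤ 1 - Real.exp (-1) → -Real.log (1 - p) ≤ 1 := by
    intro h
    linarith [(Real.le_log_iff_exp_le hq).mpr (show Real.exp (-1) ≤ 1 - p by linarith)]
  have hlarge : 1 - Real.exp (-1) ≤ p → 1 ≤ -Real.log (1 - p) := by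
    intro h
    linarith [(Real.log_le_iff_le_exp hq).mpr (show 1 - p ≤ Real.exp (-1) by linarith)]
  have heq_small : p ≤ 1 - Real.exp (-1) →
      dtv (bernoulliPMF p) (poissonPMF (min (-Real.log (1 - p)) 1)) =
        p + (1 - p) * Real.log (1 - p) := by
    intro h
    rw [min_eq_left (hsmall h), dtv_eq_of_one_sub_le_exp_neg hlog hexp.ge, hexp]
    ring
  have heq_large : 1 - Real.exp (-1) ≤ p →
      dtv (bernoulliPMF p) (poissonPMF (min (-Real.log (1 - p)) 1)) = p - Real.exp (-1) := by
    intro h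
    rw [min_eq_right (hlarge h), dtv_eq_of_one_sub_le_exp_neg zero_le_one (by linarith), one_mul]
  refine ⟨fun l hl => ?_, heq_small, heq_large⟩
  rcases le_total p (1 - Real.exp (-1)) with h | h
  · rw [heq_small h]
    rcases le_total l (-Real.log (1 - p)) with hls | hsl
    · have hmono := mul_exp_neg_le_of_le_one hlog hls (hsmall h)
      rw [hexp] at hmono
      linarith [sub_mul_exp_neg_le_dtv p hl.le]
    · have hmono := one_add_mul_exp_neg_le hlog hsl
      rw [hexp] at hmono
      linarith [one_sub_le_dtv p hl.le]
  · rw [heq_large h]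
    linarith [sub_mul_exp_neg_le_dtv p hl.le, mul_exp_neg_le_exp_neg_one l]
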